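/- (Loh) Every r-edge-coloured tournament of order n contains a monochromatic directed path of edge-length at least n^{1/r} − 1. -/

import Mathlib

/-- A walk in the relation `R` with the additional arc `(u, v)` either avoids that arc or
passes through `u` and later through `v`. -/
theorem transGen_insert_arc {V : Type*} {R : V → V → Prop} {u v a b : V}
    (h : Relation.TransGen (fun x y => R x y ∨ (x = u ∧ y = v)) a b) :
    Relation.TransGen R a b ∨
      (Relation.ReflTransGen R a u ∧ Relation.ReflTransGen R v b) := by
  induction h with
  | single h =>
    rcases h with h | ⟨rfl, rfl⟩
    · exact .inl (.single h)
    · exact .inr ⟨.refl, .refl⟩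
  | tail _ h ih =>
    rcases h with h | ⟨rfl, rfl⟩
    · rcases ih with ih | ⟨h₁, h₂⟩
      · exact .inl (ih.tail h)
      · exact .inr ⟨h₁, h₂.tail h⟩
    · rcases ih with ih | ⟨h₁, _⟩
      · exact .inr ⟨ih.to_reflTransGen, .refl⟩
      · exact .inr ⟨h₁, .refl⟩

/-- A chain of an acyclic relation has no repeated entries. -/
theorem List.IsChain.nodup_of_acyclic {V : Type*} {R : V → V → Prop}
    (hR : ∀ v, ¬ Relation.TransGen R v v) {l : List V} (hl : l.IsChain R) : l.Nodup := by
  have h : l.IsChain (Relation.TransGen R) := hl.imp fun _ _ => Relation.TransGen.single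
  refine (List.isChain_iff_pairwise.mp h).imp ?_
  rintro a _ hab rfl
  exact hR a hab

/-- A relation whose chains have at most `k` vertices admits a height function with
values below `k` that strictly decreases along arcs. -/
theorem exists_height_of_chains_length_le {V : Type*} {R : V → V → Prop} {k : ℕ}
    (hk : ∀ l : List V, l.IsChain R → l.length ≤ k) :
    ∃ f : V → Fin k, ∀ u v, R u v → f v < f u := by
  have hmax : ∀ v, ∃ m, (∃ t : List V, (v :: t).IsChain R ∧ t.length = m) ∧
      ∀ t : List V, (v :: t).IsChain R → t.length ≤ m := by
    intro v
    have hbdd : BddAbove {m | ∃ t : List V, (v :: t).IsChain R ∧ t.length = m} := by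
      refine ⟨k, ?_⟩
      rintro _ ⟨t, ht, rfl⟩
      exact (Nat.le_succ _).trans (hk _ ht)
    have hne : {m | ∃ t : List V, (v :: t).IsChain R ∧ t.length = m}.Nonempty :=
      ⟨0, [], by simp, rfl⟩
    exact ⟨_, Nat.sSup_mem hne hbdd, fun t ht => le_csSup hbdd ⟨t, ht, rfl⟩⟩
  choose f hf hf_max using hmax
  refine ⟨fun v => ⟨f v, ?_⟩, fun u v huv => ?_⟩
  · obtain ⟨t, ht, htf⟩ := hf v
    have := hk _ ht
    rw [List.length_cons] at this
    omega
  · obtain ⟨t, ht, htf⟩ := hf v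
    have := hf_max u (v :: t) (List.isChain_cons_cons.mpr ⟨huv, ht⟩)
    rw [List.length_cons] at this
    rw [Fin.mk_lt_mk]
    omega

/-- Gallai–Roy: a finite loopless digraph whose directed paths have at most `k` vertices has a
proper colouring with `k` colours. -/
theorem exists_colouring_of_paths_length_le {V : Type*} [Finite V] {D : V → V → Prop}
    (hD : ∀ v, ¬ D v v) {k : ℕ}
    (hk : ∀ l : List V, l.Nodup → l.IsChain D → l.length ≤ k) :
    ∃ f : V → Fin k, ∀ u v, D u v → f u ≠ f v := by
  obtain ⟨R, ⟨hRD, hR⟩, hmax⟩ := Set.Finite.exists_maximal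
    (Set.toFinite {R : V → V → Prop | R ≤ D ∧ ∀ v, ¬ Relation.TransGen R v v})
    ⟨fun _ _ => False, fun _ _ h => h.elim, fun v h => by
      obtain ⟨_, h, _⟩ := Relation.TransGen.head'_iff.mp h
      exact h⟩
  obtain ⟨f, hf⟩ := exists_height_of_chains_length_le (R := R) (k := k) fun l hl =>
    hk l (hl.nodup_of_acyclic hR) (hl.imp hRD)
  have hf_trans : ∀ {u v}, Relation.TransGen R u v → f v < f u := by
    intro u v h
    induction h with
    | single h => exact hf _ _ h
    | tail _ h ih => exact (hf _ _ h).trans ih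
  refine ⟨f, fun u v huv => ?_⟩
  by_cases hRuv : R u v
  · exact (hf u v hRuv).ne'
  obtain ⟨x, hx⟩ : ∃ x, Relation.TransGen (fun a b => R a b ∨ (a = u ∧ b = v)) x x := by
    by_contra! hacyclic
    refine hRuv (hmax (y := fun a b => R a b ∨ (a = u ∧ b = v)) ⟨?_, hacyclic⟩
      (fun _ _ h => Or.inl h) u v (.inr ⟨rfl, rfl⟩))
    rintro a b (h | ⟨rfl, rfl⟩)
    · exact hRD a b h
    · exact huv
  rcases transGen_insert_arc hx with h | ⟨hxu, hvx⟩
  · exact (hR x h).elim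
  · rcases Relation.reflTransGen_iff_eq_or_transGen.mp (hvx.trans hxu) with h | h
    · exact (hD v (h ▸ huv)).elim
    · exact (hf_trans h).ne

/-- Loh: every `r`-edge-coloured finite tournament of order `n` contains a monochromatic
directed path of edge-length at least `n^(1/r) - 1`. A directed path is a list of distinct
vertices with consecutive directed edges; its edge-length is `l.length - 1`. -/
theorem mono_path_in_coloured_tournament {V : Type*} [Fintype V]
    (E : V → V → Prop) (hirr : ∀ v, ¬ E v v)
    (htour : ∀ u v : V, u ≠ v → (E u v ↔ ¬ E v u))
    (r : ℕ) (hr : 0 < r) (c : V → V → Fin r) :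
    ∃ j : Fin r, ∃ l : List V, l.Nodup ∧
      l.Chain' (fun u v => E u v ∧ c u v = j) ∧
      (Fintype.card V : ℝ) ^ ((1 : ℝ) / r) - 1 ≤ (l.length : ℝ) - 1 := by
  let S : Set ℕ := {m | ∃ j : Fin r, ∃ l : List V, l.Nodup ∧
    l.IsChain (fun u v => E u v ∧ c u v = j) ∧ l.length = m}
  have hbdd : BddAbove S := by
    refine ⟨Fintype.card V, ?_⟩
    rintro _ ⟨_, l, hl, _, rfl⟩
    exact hl.length_le_card
  obtain ⟨j, l, hl, hchain, hlen⟩ : sSup S ∈ S :=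
    Nat.sSup_mem ⟨0, ⟨0, hr⟩, [], by simp, by simp, rfl⟩ hbdd
  refine ⟨j, l, hl, hchain, sub_le_sub_right ?_ 1⟩
  have hcol : ∀ i : Fin r, ∃ f : V → Fin (sSup S), ∀ u v, E u v ∧ c u v = i → f u ≠ f v :=
    fun i => exists_colouring_of_paths_length_le (fun v h => hirr v h.1)
      fun l hl hc => le_csSup hbdd ⟨i, l, hl, hc, rfl⟩
  choose f hf using hcol
  have hinj : Function.Injective fun v i => f i v := by
    intro u v huv
    by_contra hne
    by_cases hE : E u v
    · exact hf _ u v ⟨hE, rfl⟩ (congrFun huv _)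
    · exact hf _ v u ⟨(htour v u (Ne.symm hne)).mpr hE, rfl⟩ (congrFun huv _).symm
  have hcard : Fintype.card V ≤ l.length ^ r := by
    simpa [hlen] using Fintype.card_le_of_injective _ hinj
  calc (Fintype.card V : ℝ) ^ ((1 : ℝ) / r)
      ≤ ((l.length : ℝ) ^ r) ^ ((1 : ℝ) / r) := by
        gcongr
        exact_mod_cast hcard
    _ = l.length := by
        rw [one_div, Real.pow_rpow_inv_natCast (Nat.cast_nonneg _) hr.ne']
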